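/- arXiv:1902.01957 — 9 statements merged into one kernel-verified Lean document; each statement's English description precedes it below -/
import Mathlib

section
/- Let X be a locally compact, locally connected Hausdorff space, K a compact subset of X, U an open subset of X with K ⊆ U. If K is connected or U is connected, then there exists an open connected set V with compact closure such that K ⊆ V ⊆ closure(V) ⊆ U and closure(V) is compact and connected. -/
open Set

theorem IsConnected.exists_isOpen_isConnected_isCompact_closure
    {X : Type*} [TopologicalSpace X] [LocallyCompactSpace X] [LocallyConnectedSpace X]
    [T2Space X] {K U : Set X} (hcon : IsConnected K) (hK : IsCompact K) (hU : IsOpen U)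
    (hKU : K ⊆ U) :
    ∃ V : Set X, IsOpen V ∧ IsConnected V ∧ K ⊆ V ∧ closure V ⊆ U ∧ IsCompact (closure V) := by
  obtain ⟨W, hW, hKW, hWU, hWc⟩ := exists_open_between_and_isCompact_closure hK hU hKU
  obtain ⟨x, hx⟩ := hcon.nonempty
  have hcl : closure (connectedComponentIn W x) ⊆ closure W :=
    closure_mono (connectedComponentIn_subset W x)
  exact ⟨connectedComponentIn W x, hW.connectedComponentIn,
    isConnected_connectedComponentIn_iff.2 (hKW hx),
    hcon.isPreconnected.subset_connectedComponentIn hx hKW, hcl.trans hWU,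
    hWc.of_isClosed_subset isClosed_closure hcl⟩

theorem IsPreconnected.exists_isOpen_isConnected_isCompact_closure_of_mem
    {X : Type*} [TopologicalSpace X] [LocallyCompactSpace X] [LocallyConnectedSpace X]
    [T2Space X] {U : Set X} (hcon : IsPreconnected U) (hU : IsOpen U) {x y : X}
    (hx : x ∈ U) (hy : y ∈ U) :
    ∃ V : Set X, IsOpen V ∧ IsConnected V ∧ x ∈ V ∧ y ∈ V ∧ closure V ⊆ U ∧
      IsCompact (closure V) := by
  refine hcon.induction₂ (fun x y ↦ ∃ V : Set X, IsOpen V ∧ IsConnected V ∧ x ∈ V ∧ y ∈ V ∧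
    closure V ⊆ U ∧ IsCompact (closure V)) (fun z hz ↦ ?_) ?_ ?_ hx hy
  · obtain ⟨V, hV, hVc, hzV, hVU, hVk⟩ :=
      isConnected_singleton.exists_isOpen_isConnected_isCompact_closure isCompact_singleton hU
        (singleton_subset_iff.2 hz)
    rw [singleton_subset_iff] at hzV
    filter_upwards [mem_nhdsWithin_of_mem_nhds (hV.mem_nhds hzV)] with w hw
    exact ⟨V, hV, hVc, hzV, hw, hVU, hVk⟩
  · rintro a b c - - - ⟨V, hV, hVc, haV, hbV, hVU, hVk⟩ ⟨W, hW, hWc, hbW, hcW, hWU, hWk⟩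
    refine ⟨V ∪ W, hV.union hW, hVc.union ⟨b, hbV, hbW⟩ hWc, Or.inl haV, Or.inr hcW, ?_, ?_⟩
    · rw [closure_union]
      exact union_subset hVU hWU
    · rw [closure_union]
      exact hVk.union hWk
  · rintro a b - - ⟨V, hV, hVc, haV, hbV, hVU, hVk⟩
    exact ⟨V, hV, hVc, hbV, haV, hVU, hVk⟩

theorem IsCompact.exists_isOpen_isConnected_isCompact_closure_of_isConnected
    {X : Type*} [TopologicalSpace X] [LocallyCompactSpace X] [LocallyConnectedSpace X]
    [T2Space X] {K U : Set X} (hK : IsCompact K) (hU : IsOpen U) (hKU : K ⊆ U)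
    (hcon : IsConnected U) :
    ∃ V : Set X, IsOpen V ∧ IsConnected V ∧ K ⊆ V ∧ closure V ⊆ U ∧ IsCompact (closure V) := by
  obtain ⟨x, hx⟩ := hcon.nonempty
  suffices h : ∃ V : Set X, IsOpen V ∧ IsConnected V ∧ x ∈ V ∧ K ⊆ V ∧ closure V ⊆ U ∧
      IsCompact (closure V) by
    obtain ⟨V, hV, hVc, -, h⟩ := h
    exact ⟨V, hV, hVc, h⟩
  refine hK.induction_on (p := fun s ↦ ∃ V : Set X, IsOpen V ∧ IsConnected V ∧ x ∈ V ∧ s ⊆ V ∧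
    closure V ⊆ U ∧ IsCompact (closure V)) ?_ ?_ ?_ fun y hy ↦ ?_
  · obtain ⟨V, hV, hVc, hxV, -, h⟩ :=
      hcon.isPreconnected.exists_isOpen_isConnected_isCompact_closure_of_mem hU hx hx
    exact ⟨V, hV, hVc, hxV, empty_subset V, h⟩
  · rintro s t hst ⟨V, hV, hVc, hxV, htV, h⟩
    exact ⟨V, hV, hVc, hxV, hst.trans htV, h⟩
  · rintro s t ⟨V, hV, hVc, hxV, hsV, hVU, hVk⟩ ⟨W, hW, hWc, hxW, htW, hWU, hWk⟩
    refine ⟨V ∪ W, hV.union hW, hVc.union ⟨x, hxV, hxW⟩ hWc, Or.inl hxV,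
      union_subset_union hsV htW, ?_, ?_⟩
    · rw [closure_union]
      exact union_subset hVU hWU
    · rw [closure_union]
      exact hVk.union hWk
  · obtain ⟨V, hV, hVc, hxV, hyV, h⟩ :=
      hcon.isPreconnected.exists_isOpen_isConnected_isCompact_closure_of_mem hU hx (hKU hy)
    exact ⟨V, mem_nhdsWithin_of_mem_nhds (hV.mem_nhds hyV), V, hV, hVc, hxV, Subset.rfl, h⟩

/-- Let `X` be a locally compact, locally connected Hausdorff space, `K ⊆ U` with `K` compact
and `U` open. If `K` is connected or `U` is connected, then there is an open connected set `V`
with compact connected closure such that `K ⊆ V ⊆ closure V ⊆ U`. -/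
theorem exists_open_connected_between_compact_and_open
    {X : Type*} [TopologicalSpace X] [LocallyCompactSpace X] [LocallyConnectedSpace X]
    [T2Space X] (K U : Set X) (hK : IsCompact K) (hU : IsOpen U) (hKU : K ⊆ U)
    (hcon : IsConnected K ∨ IsConnected U) :
    ∃ V : Set X, IsOpen V ∧ IsConnected V ∧ K ⊆ V ∧ closure V ⊆ U ∧
      IsCompact (closure V) ∧ IsConnected (closure V) := by
  obtain ⟨V, hV, hVc, hKV, hVU, hVk⟩ : ∃ V : Set X, IsOpen V ∧ IsConnected V ∧ K ⊆ V ∧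
      closure V ⊆ U ∧ IsCompact (closure V) := by
    rcases hcon with h | h
    · exact h.exists_isOpen_isConnected_isCompact_closure hK hU hKU
    · exact hK.exists_isOpen_isConnected_isCompact_closure_of_isConnected hU hKU h
  exact ⟨V, hV, hVc, hKV, hVU, hVk, hVc.closure⟩
end

section
/- Let X be a connected, locally connected Hausdorff space, K a compact subset of X, and U an open connected set with compact closure such that K ⊆ U. Then at most finitely many connected components of X ∖ K are not contained in U. -/
open Set

/-- `C` is a connected component of the set `S` (in the ambient space `X`). -/
def IsCompOf {X : Type*} [TopologicalSpace X] (C S : Set X) : Prop :=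
  ∃ x ∈ S, C = connectedComponentIn S x

theorem isClosed_connectedComponentIn_of_closure_subset {X : Type*} [TopologicalSpace X]
    {S : Set X} {x : X} (hx : x ∈ S) (h : closure (connectedComponentIn S x) ⊆ S) :
    IsClosed (connectedComponentIn S x) :=
  isClosed_of_closure_subset <|
    isPreconnected_connectedComponentIn.closure.subset_connectedComponentIn
      (subset_closure (mem_connectedComponentIn hx)) h

theorem connectedComponentIn_inter_frontier_nonempty {X : Type*} [TopologicalSpace X]
    [ConnectedSpace X] [LocallyConnectedSpace X] {S U : Set X} {x : X} (hS : IsOpen S)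
    (hU : IsOpen U) (hne : U.Nonempty) (hSU : Uᶜ ⊆ S) (hx : x ∈ S)
    (hC : ¬ connectedComponentIn S x ⊆ U) :
    (connectedComponentIn S x ∩ frontier U).Nonempty := by
  by_contra hfr
  have hdisj : Disjoint U (connectedComponentIn S x) := by
    rw [disjoint_iff_inter_eq_empty, inter_comm, ← not_nonempty_iff_eq_empty]
    intro hmeet
    refine hC (isPreconnected_connectedComponentIn.subset_of_closure_inter_subset hU hmeet ?_)
    rintro y ⟨hyU, hyC⟩
    by_contra hy
    exact hfr ⟨y, hyC, hU.frontier_eq ▸ ⟨hyU, hy⟩⟩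
  have hclosed : IsClosed (connectedComponentIn S x) :=
    isClosed_connectedComponentIn_of_closure_subset hx
      ((hdisj.closure_right hU).subset_compl_left.trans hSU)
  have huniv : connectedComponentIn S x = univ :=
    IsClopen.eq_univ ⟨hclosed, hS.connectedComponentIn⟩ ⟨x, mem_connectedComponentIn hx⟩
  rw [huniv, disjoint_univ] at hdisj
  exact hne.ne_empty hdisj

theorem IsCompact.finite_connectedComponentIn_inter_nonempty {X : Type*} [TopologicalSpace X]
    [LocallyConnectedSpace X] {S F : Set X} (hS : IsOpen S) (hF : IsCompact F) (hFS : F ⊆ S) :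
    {C : Set X | IsCompOf C S ∧ (C ∩ F).Nonempty}.Finite := by
  obtain ⟨t, -, ht⟩ := hF.elim_nhds_subcover (connectedComponentIn S)
    fun x hx ↦ connectedComponentIn_mem_nhds (hS.mem_nhds (hFS hx))
  refine (t.finite_toSet.image (connectedComponentIn S)).subset ?_
  rintro _ ⟨⟨x, -, rfl⟩, y, hyC, hyF⟩
  obtain ⟨z, hz, hyz⟩ := mem_iUnion₂.1 (ht hyF)
  exact ⟨z, hz, (connectedComponentIn_eq hyz).trans (connectedComponentIn_eq hyC).symm⟩

/-- Let `X` be a connected, locally connected Hausdorff space, `K` compact, `U` open connected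
with compact closure and `K ⊆ U`. Then at most finitely many connected components of `X \ K`
are not contained in `U`. -/
theorem finitely_many_components_not_in_U
    {X : Type*} [TopologicalSpace X] [ConnectedSpace X] [LocallyConnectedSpace X]
    [T2Space X] (K U : Set X) (hK : IsCompact K) (hU : IsOpen U) (hUc : IsConnected U)
    (hUb : IsCompact (closure U)) (hKU : K ⊆ U) :
    {C : Set X | IsCompOf C Kᶜ ∧ ¬ C ⊆ U}.Finite := by
  have hS : IsOpen Kᶜ := hK.isClosed.isOpen_compl
  have hSU : Uᶜ ⊆ Kᶜ := compl_subset_compl.2 hKU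
  have hF : IsCompact (frontier U) :=
    hUb.of_isClosed_subset isClosed_frontier frontier_subset_closure
  have hFS : frontier U ⊆ Kᶜ := fun y hy ↦ hSU (hU.frontier_eq ▸ hy).2
  refine (hF.finite_connectedComponentIn_inter_nonempty hS hFS).subset ?_
  rintro _ ⟨⟨x, hx, rfl⟩, hC⟩
  exact ⟨⟨x, hx, rfl⟩,
    connectedComponentIn_inter_frontier_nonempty hS hU hUc.nonempty hSU hx hC⟩
end

section
/- Let X be a locally compact, connected, locally connected Hausdorff space and K a compact subset of X. Then the union W of all bounded connected components of X ∖ K is an open set with compact closure. -/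
open Set

/-- In a locally connected space, a component of an open set is relatively closed in it. -/
theorem closure_connectedComponentIn_inter_subset {X : Type*} [TopologicalSpace X]
    [LocallyConnectedSpace X] {U : Set X} (hU : IsOpen U) (x : X) :
    closure (connectedComponentIn U x) ∩ U ⊆ connectedComponentIn U x := by
  rintro y ⟨hy, hyU⟩
  obtain ⟨z, hzy, hzx⟩ := mem_closure_iff.1 hy _ hU.connectedComponentIn
    (mem_connectedComponentIn hyU)
  rw [connectedComponentIn_eq hzx, ← connectedComponentIn_eq hzy]
  exact mem_connectedComponentIn hyU

/-- A component of the complement of a set `K` in a connected, locally connected space cannot be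
separated from `K` by a closed set `L` whose interior contains `K`, unless it is everything. -/
theorem connectedComponentIn_compl_eq_univ {X : Type*} [TopologicalSpace X] [ConnectedSpace X]
    [LocallyConnectedSpace X] {K L : Set X} (hK : IsClosed K) (hKL : K ⊆ interior L) {x : X}
    (hx : x ∈ Kᶜ) (hL : connectedComponentIn Kᶜ x ⊆ Lᶜ) :
    connectedComponentIn Kᶜ x = univ := by
  refine IsClopen.eq_univ ⟨isClosed_of_closure_subset fun y hy ↦ ?_,
    hK.isOpen_compl.connectedComponentIn⟩ ⟨x, mem_connectedComponentIn hx⟩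
  refine closure_connectedComponentIn_inter_subset hK.isOpen_compl x ⟨hy, fun hyK ↦ ?_⟩
  have h := closure_mono hL hy
  rw [closure_compl] at h
  exact h (hKL hyK)

/-- Let `X` be a locally compact, connected, locally connected Hausdorff space and `K` compact.
Then the union of all bounded connected components of `X \ K` is open and has compact
closure. -/
theorem union_bounded_components_open_and_bounded
    {X : Type*} [TopologicalSpace X] [LocallyCompactSpace X] [ConnectedSpace X]
    [LocallyConnectedSpace X] [T2Space X] (K : Set X) (hK : IsCompact K) :
    IsOpen (⋃₀ {C : Set X | IsCompOf C Kᶜ ∧ IsCompact (closure C)}) ∧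
    IsCompact (closure (⋃₀ {C : Set X | IsCompOf C Kᶜ ∧ IsCompact (closure C)})) := by
  refine ⟨isOpen_sUnion ?_, ?_⟩
  · rintro _ ⟨⟨x, -, rfl⟩, -⟩
    exact hK.isClosed.isOpen_compl.connectedComponentIn
  by_cases hX : CompactSpace X
  · exact isClosed_closure.isCompact
  obtain ⟨L, hL, hKL⟩ := exists_compact_superset hK
  classical
  obtain ⟨t, ht⟩ := (hL.diff isOpen_interior).elim_finite_subcover (connectedComponentIn Kᶜ)
    (fun x ↦ hK.isClosed.isOpen_compl.connectedComponentIn)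
    (fun x hx ↦ mem_iUnion.2 ⟨x, mem_connectedComponentIn fun hxK ↦ hx.2 (hKL hxK)⟩)
  let s := t.filter fun x ↦ IsCompact (closure (connectedComponentIn Kᶜ x))
  have hs : IsCompact (⋃ x ∈ s, closure (connectedComponentIn Kᶜ x)) :=
    s.isCompact_biUnion fun x hx ↦ (Finset.mem_filter.1 hx).2
  refine (hL.union hs).closure_of_subset (sUnion_subset ?_)
  rintro _ ⟨⟨x, hx, rfl⟩, hC⟩
  by_cases hF : (connectedComponentIn Kᶜ x ∩ (L \ interior L)).Nonempty
  · obtain ⟨y, hyC, hyF⟩ := hF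
    obtain ⟨z, hz, hyz⟩ := mem_iUnion₂.1 (ht hyF)
    have hzx : connectedComponentIn Kᶜ z = connectedComponentIn Kᶜ x :=
      (connectedComponentIn_eq hyz).trans (connectedComponentIn_eq hyC).symm
    have hzs : z ∈ s := Finset.mem_filter.2 ⟨hz, hzx ▸ hC⟩
    exact hzx ▸ (subset_closure.trans
      (subset_biUnion_of_mem (u := fun x ↦ closure (connectedComponentIn Kᶜ x)) hzs)).trans
      subset_union_right
  · have hcover : connectedComponentIn Kᶜ x ⊆ interior L ∪ Lᶜ := fun y hy ↦ by
      by_contra h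
      simp only [mem_union, mem_compl_iff, not_or, not_not] at h
      exact hF ⟨y, hy, h.2, h.1⟩
    rcases isPreconnected_connectedComponentIn.subset_or_subset isOpen_interior
      hL.isClosed.isOpen_compl (disjoint_compl_right.mono_left interior_subset) hcover with h | h
    · exact h.trans (interior_subset.trans subset_union_left)
    · rw [connectedComponentIn_compl_eq_univ hK.isClosed hKL hx h, closure_univ] at hC
      exact absurd ⟨hC⟩ hX
end

section
/- Let X be a locally compact, connected, locally connected Hausdorff space. Suppose A ⊆ B where B is a bounded set that is compact or open (i.e. B has compact closure). Then every unbounded connected component of X ∖ B is contained in an unbounded connected component of X ∖ A, and every unbounded connected component of X ∖ A contains an unbounded connected component of X ∖ B. -/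
open Set

/-- A component of the complement of a nonempty closed set `K` in a connected, locally connected
space either meets the frontier of a given open neighbourhood of `K` or lies inside it. -/
theorem connectedComponentIn_compl_subset_of_disjoint_frontier {X : Type*} [TopologicalSpace X]
    [ConnectedSpace X] [LocallyConnectedSpace X] {K V : Set X} (hK : IsClosed K)
    (hKne : K.Nonempty) (hV : IsOpen V) (hKV : K ⊆ V) {x : X} (hx : x ∈ Kᶜ)
    (hd : ¬ (connectedComponentIn Kᶜ x ∩ frontier V).Nonempty) :
    connectedComponentIn Kᶜ x ⊆ V := by
  have hpre : IsPreconnected (connectedComponentIn Kᶜ x) := isPreconnected_connectedComponentIn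
  have hmeet : (closure (connectedComponentIn Kᶜ x) ∩ K).Nonempty := by
    by_contra hne
    have hsub : closure (connectedComponentIn Kᶜ x) ⊆ Kᶜ := fun y hy hyK => hne ⟨y, hy, hyK⟩
    have hclosed : IsClosed (connectedComponentIn Kᶜ x) :=
      isClosed_of_closure_subset (hpre.closure.subset_connectedComponentIn
        (subset_closure (mem_connectedComponentIn hx)) hsub)
    have huniv : connectedComponentIn Kᶜ x = univ :=
      IsClopen.eq_univ ⟨hclosed, hK.isOpen_compl.connectedComponentIn⟩
        ⟨x, mem_connectedComponentIn hx⟩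
    obtain ⟨k, hk⟩ := hKne
    exact connectedComponentIn_subset Kᶜ x (huniv ▸ mem_univ k) hk
  obtain ⟨p, hpC, hpK⟩ := hmeet
  obtain ⟨q, hqV, hqC⟩ := mem_closure_iff.1 hpC V hV (hKV hpK)
  refine hpre.subset_left_of_subset_union hV isClosed_closure.isOpen_compl
    (disjoint_compl_right.mono_left subset_closure) (fun r hr => ?_) ⟨q, hqC, hqV⟩
  by_contra hnot
  rw [mem_union, not_or, mem_compl_iff, not_not] at hnot
  exact hd ⟨r, hr, hV.frontier_eq ▸ ⟨hnot.2, hnot.1⟩⟩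

/-- If `K` is nonempty and compact and `A ⊆ K`, then every unbounded component of `Aᶜ` contains
an unbounded component of `Kᶜ`. -/
theorem exists_unbounded_connectedComponentIn_compl_subset {X : Type*} [TopologicalSpace X]
    [LocallyCompactSpace X] [ConnectedSpace X] [LocallyConnectedSpace X] [T2Space X]
    {A K : Set X} (hAK : A ⊆ K) (hK : IsCompact K) (hKne : K.Nonempty) {d : X}
    (hD : ¬ IsCompact (closure (connectedComponentIn Aᶜ d))) :
    ∃ x ∈ Kᶜ, ¬ IsCompact (closure (connectedComponentIn Kᶜ x)) ∧
      connectedComponentIn Kᶜ x ⊆ connectedComponentIn Aᶜ d := by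
  by_contra! hcon
  obtain ⟨V, hV, hKV, hVc⟩ := exists_isOpen_superset_and_isCompact_closure hK
  have hfr : IsCompact (frontier V) := hVc.of_isClosed_subset isClosed_frontier
    frontier_subset_closure
  have hfrK : frontier V ⊆ Kᶜ := fun y hy hyK => by
    rw [hV.frontier_eq] at hy
    exact hy.2 (hKV hyK)
  obtain ⟨t, ht, hcover⟩ := hfr.elim_nhds_subcover (fun x => connectedComponentIn Kᶜ x)
    fun x hx => hK.isClosed.isOpen_compl.connectedComponentIn.mem_nhds
      (mem_connectedComponentIn (hfrK hx))
  have hsubD : ∀ y ∈ connectedComponentIn Aᶜ d,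
      connectedComponentIn Kᶜ y ⊆ connectedComponentIn Aᶜ d := fun y hy => by
    rw [connectedComponentIn_eq hy]
    exact connectedComponentIn_mono y (compl_subset_compl.2 hAK)
  have hbounded : ∀ x ∈ Kᶜ, x ∈ connectedComponentIn Aᶜ d →
      IsCompact (closure (connectedComponentIn Kᶜ x)) := fun x hxK hxD => by
    by_contra hx
    exact hcon x hxK hx (hsubD x hxD)
  have hfin : {x | x ∈ t ∧ x ∈ connectedComponentIn Aᶜ d}.Finite :=
    t.finite_toSet.subset fun x hx => hx.1
  have hcompact : IsCompact (closure V ∪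
      ⋃ x ∈ {x | x ∈ t ∧ x ∈ connectedComponentIn Aᶜ d},
        closure (connectedComponentIn Kᶜ x)) :=
    hVc.union (hfin.isCompact_biUnion fun x hx => hbounded x (hfrK (ht x hx.1)) hx.2)
  refine hD (hcompact.closure_of_subset fun y hy => ?_)
  by_cases hyV : y ∈ V
  · exact Or.inl (subset_closure hyV)
  have hyK : y ∈ Kᶜ := fun h => hyV (hKV h)
  have hyC := mem_connectedComponentIn hyK
  obtain ⟨z, hzC, hzV⟩ : (connectedComponentIn Kᶜ y ∩ frontier V).Nonempty := by
    by_contra hne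
    exact hyV (connectedComponentIn_compl_subset_of_disjoint_frontier hK.isClosed hKne hV hKV
      hyK hne hyC)
  obtain ⟨x, hxt, hzx⟩ := mem_iUnion₂.1 (hcover hzV)
  have hxy : connectedComponentIn Kᶜ x = connectedComponentIn Kᶜ y :=
    (connectedComponentIn_eq hzx).trans (connectedComponentIn_eq hzC).symm
  have hxC : x ∈ connectedComponentIn Kᶜ y :=
    hxy ▸ mem_connectedComponentIn (hfrK (ht x hxt))
  refine Or.inr (mem_iUnion₂.2 ⟨x, ⟨hxt, hsubD y hy hxC⟩, subset_closure ?_⟩)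
  rwa [hxy]

/-- Let `X` be a locally compact, connected, locally connected Hausdorff space and `A ⊆ B`,
where `B` is bounded (compact closure) and compact or open. Then every unbounded component of
`X \ B` is contained in an unbounded component of `X \ A`, and every unbounded component of
`X \ A` contains an unbounded component of `X \ B`. -/
theorem unbounded_components_correspondence
    {X : Type*} [TopologicalSpace X] [LocallyCompactSpace X] [ConnectedSpace X]
    [LocallyConnectedSpace X] [T2Space X] (A B : Set X) (hAB : A ⊆ B)
    (hB : IsCompact B ∨ IsOpen B) (hBb : IsCompact (closure B)) :
    (∀ C : Set X, IsCompOf C Bᶜ → ¬ IsCompact (closure C) →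
      ∃ D : Set X, IsCompOf D Aᶜ ∧ ¬ IsCompact (closure D) ∧ C ⊆ D) ∧
    (∀ D : Set X, IsCompOf D Aᶜ → ¬ IsCompact (closure D) →
      ∃ C : Set X, IsCompOf C Bᶜ ∧ ¬ IsCompact (closure C) ∧ C ⊆ D) := by
  constructor
  · rintro _ ⟨x, hx, rfl⟩ hC
    have hsub := connectedComponentIn_mono x (compl_subset_compl.2 hAB)
    exact ⟨_, ⟨x, fun h => hx (hAB h), rfl⟩, fun h => hC (h.closure_of_subset
      (hsub.trans subset_closure)), hsub⟩
  · rintro _ ⟨d, -, rfl⟩ hD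
    have hBK : B ⊆ insert d (closure B) := subset_closure.trans (subset_insert _ _)
    obtain ⟨x, hxK, hx, hxD⟩ := exists_unbounded_connectedComponentIn_compl_subset
      (hAB.trans hBK) (hBb.insert d) (insert_nonempty _ _) hD
    have hxB : x ∈ Bᶜ := fun h => hxK (hBK h)
    refine ⟨_, ⟨x, hxB, rfl⟩, fun h => hx (h.closure_of_subset
      ((connectedComponentIn_mono x (compl_subset_compl.2 hBK)).trans subset_closure)), ?_⟩
    rw [connectedComponentIn_eq (hxD (mem_connectedComponentIn hxK))]
    exact connectedComponentIn_mono x (compl_subset_compl.2 hAB)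
end

section
/- Let X be a locally compact, connected, locally connected Hausdorff space, and let A be a subset of X that is either compact or open with compact closure. Then X ∖ A has only finitely many unbounded connected components. -/
open Set

/-- In a connected, locally connected space, a component of the complement of a closed set `K`
which is not contained in a nonempty open set `U ⊇ K` meets the frontier of `U`. -/
theorem connectedComponentIn_compl_inter_frontier_nonempty
    {X : Type*} [TopologicalSpace X] [ConnectedSpace X] [LocallyConnectedSpace X]
    {K U : Set X} (hK : IsClosed K) (hU : IsOpen U) (hKU : K ⊆ U) (hne : U.Nonempty)
    {x : X} (hx : x ∉ U) :
    (connectedComponentIn Kᶜ x ∩ frontier U).Nonempty := by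
  have hxK : x ∈ Kᶜ := fun h => hx (hKU h)
  have hpre : IsPreconnected (connectedComponentIn Kᶜ x) := isPreconnected_connectedComponentIn
  have hxD : x ∈ connectedComponentIn Kᶜ x := mem_connectedComponentIn hxK
  have hmeet : (connectedComponentIn Kᶜ x ∩ U).Nonempty := by
    by_contra hdisj
    have hcl : closure (connectedComponentIn Kᶜ x) ⊆ Uᶜ :=
      closure_minimal (fun y hy hyU => hdisj ⟨y, hy, hyU⟩) hU.isClosed_compl
    have hclosed : IsClosed (connectedComponentIn Kᶜ x) := by
      refine isClosed_of_closure_subset ?_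
      exact hpre.closure.subset_connectedComponentIn (subset_closure hxD)
        (hcl.trans (compl_subset_compl.2 hKU))
    have huniv := IsClopen.eq_univ ⟨hclosed, hK.isOpen_compl.connectedComponentIn⟩ ⟨x, hxD⟩
    obtain ⟨y, hy⟩ := hne
    exact hdisj ⟨y, huniv ▸ mem_univ y, hy⟩
  by_contra hfr
  have hsub : connectedComponentIn Kᶜ x ⊆ U ∪ (closure U)ᶜ := by
    intro y hy
    by_contra h
    rw [mem_union, not_or, notMem_compl_iff] at h
    exact hfr ⟨y, hy, hU.frontier_eq ▸ ⟨h.2, h.1⟩⟩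
  obtain ⟨y, -, hyU, hy⟩ := hpre U (closure U)ᶜ hU isClosed_closure.isOpen_compl hsub hmeet
    ⟨x, hxD, (hsub hxD).resolve_left hx⟩
  exact hy (subset_closure hyU)

/-- Let `X` be a locally compact, connected, locally connected Hausdorff space and `A` a set
that is compact, or open with compact closure. Then `X \ A` has only finitely many unbounded
connected components. -/
theorem finitely_many_unbounded_components
    {X : Type*} [TopologicalSpace X] [LocallyCompactSpace X] [ConnectedSpace X]
    [LocallyConnectedSpace X] [T2Space X] (A : Set X)
    (hA : IsCompact A ∨ (IsOpen A ∧ IsCompact (closure A))) :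
    {C : Set X | IsCompOf C Aᶜ ∧ ¬ IsCompact (closure C)}.Finite := by
  have hK : IsCompact (closure A) := hA.elim IsCompact.closure And.right
  rcases A.eq_empty_or_nonempty with rfl | hne
  · refine (finite_singleton (univ : Set X)).subset ?_
    rintro C ⟨⟨x, -, rfl⟩, -⟩
    simp [connectedComponentIn_univ, PreconnectedSpace.connectedComponent_eq_univ]
  obtain ⟨L, hL, hKL⟩ := exists_compact_superset hK
  have hfr : frontier (interior L) ⊆ L :=
    frontier_subset_closure.trans (closure_minimal interior_subset hL.isClosed)
  have hfrK : ∀ y ∈ frontier (interior L), y ∈ (closure A)ᶜ := fun y hy hyK =>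
    ((isOpen_interior (s := L)).frontier_eq ▸ hy).2 (hKL hyK)
  obtain ⟨t, -, ht⟩ := (hL.of_isClosed_subset isClosed_frontier hfr).elim_nhds_subcover
    (connectedComponentIn (closure A)ᶜ) fun y hy =>
      isClosed_closure.isOpen_compl.connectedComponentIn.mem_nhds
        (mem_connectedComponentIn (hfrK y hy))
  refine (t.finite_toSet.image (connectedComponentIn Aᶜ)).subset ?_
  rintro C ⟨⟨x, -, rfl⟩, hC⟩
  obtain ⟨z, hzC, hzL⟩ : ∃ z ∈ connectedComponentIn Aᶜ x, z ∉ interior L := by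
    by_contra! h
    exact hC (hL.of_isClosed_subset isClosed_closure
      (closure_minimal (fun z hz => interior_subset (h z hz)) hL.isClosed))
  obtain ⟨w, hwD, hw⟩ := connectedComponentIn_compl_inter_frontier_nonempty isClosed_closure
    isOpen_interior hKL (hne.mono (subset_closure.trans hKL)) hzL
  obtain ⟨f, hft, hwf⟩ := mem_iUnion₂.1 (ht hw)
  have hfK : f ∈ (closure A)ᶜ := by
    by_contra h
    simp [connectedComponentIn_eq_empty h] at hwf
  have hfz : f ∈ connectedComponentIn Aᶜ z := by
    refine connectedComponentIn_mono z (compl_subset_compl.2 subset_closure) ?_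
    rw [connectedComponentIn_eq hwD, ← connectedComponentIn_eq hwf]
    exact mem_connectedComponentIn hfK
  exact ⟨f, hft, by rw [connectedComponentIn_eq hzC, connectedComponentIn_eq hfz]⟩
end

section
/- Let X be a locally compact, connected, locally connected Hausdorff space. If K ⊆ U where K is compact and U is an open solid set with compact closure, then there exists a compact solid set C with K ⊆ C ⊆ U. -/
open Set

/-- A set is solid if it is connected and every connected component of its complement is
unbounded (has non-compact closure). -/
def Solid {X : Type*} [TopologicalSpace X] (A : Set X) : Prop :=
  IsConnected A ∧ ∀ C : Set X, IsCompOf C Aᶜ → ¬ IsCompact (closure C)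

/-- In a locally compact, locally connected Hausdorff space, compact connected neighborhoods of a
point are cofinal in its neighborhoods. -/
theorem IsOpen.exists_isCompact_isConnected_nhds_subset
    {X : Type*} [TopologicalSpace X] [LocallyCompactSpace X] [LocallyConnectedSpace X] [T2Space X]
    {U : Set X} (hU : IsOpen U) {x : X} (hx : x ∈ U) :
    ∃ D : Set X, IsCompact D ∧ IsConnected D ∧ D ∈ nhds x ∧ D ⊆ U := by
  obtain ⟨L, hL, hxL, hLU⟩ := exists_compact_subset hU hx
  have hsub : closure (connectedComponentIn (interior L) x) ⊆ L :=
    closure_minimal ((connectedComponentIn_subset _ _).trans interior_subset) hL.isClosed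
  refine ⟨closure (connectedComponentIn (interior L) x), hL.of_isClosed_subset isClosed_closure hsub,
    (isConnected_connectedComponentIn_iff.2 hxL).closure, ?_, hsub.trans hLU⟩
  exact Filter.mem_of_superset
    (isOpen_interior.connectedComponentIn.mem_nhds (mem_connectedComponentIn hxL)) subset_closure

/-- Every compact subset of an open connected set `U` lies in a compact connected subset of `U`. -/
theorem IsCompact.exists_isCompact_isConnected_between
    {X : Type*} [TopologicalSpace X] [LocallyCompactSpace X] [LocallyConnectedSpace X] [T2Space X]
    {K U : Set X} (hK : IsCompact K) (hU : IsOpen U) (hUc : IsConnected U) (hKU : K ⊆ U) :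
    ∃ D : Set X, IsCompact D ∧ IsConnected D ∧ K ⊆ D ∧ D ⊆ U := by
  obtain ⟨x₀, hx₀⟩ := hUc.nonempty
  let S : Set X := {x | ∃ D, IsCompact D ∧ IsConnected D ∧ x₀ ∈ D ∧ D ⊆ U ∧ D ∈ nhds x}
  have hSo : IsOpen S := by
    refine isOpen_iff_mem_nhds.2 ?_
    rintro x ⟨D, h1, h2, h3, h4, h5⟩
    filter_upwards [eventually_mem_nhds_iff.2 h5] with y hy
    exact ⟨D, h1, h2, h3, h4, hy⟩
  have hUS : U ⊆ S := by
    refine hUc.isPreconnected.subset_of_closure_inter_subset hSo ⟨x₀, hx₀, ?_⟩ ?_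
    · obtain ⟨D, h1, h2, h3, h4⟩ := hU.exists_isCompact_isConnected_nhds_subset hx₀
      exact ⟨D, h1, h2, mem_of_mem_nhds h3, h4, h3⟩
    · rintro y ⟨hyS, hyU⟩
      obtain ⟨N, hN, hNc, hyN, hNU⟩ := hU.exists_isCompact_isConnected_nhds_subset hyU
      obtain ⟨z, hzN, D, h1, h2, h3, h4, h5⟩ := mem_closure_iff_nhds.1 hyS N hyN
      exact ⟨D ∪ N, h1.union hN, h2.union ⟨z, mem_of_mem_nhds h5, hzN⟩ hNc, Or.inl h3,
        union_subset h4 hNU, Filter.mem_of_superset hyN subset_union_right⟩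
  suffices h : ∃ D, IsCompact D ∧ IsConnected D ∧ x₀ ∈ D ∧ D ⊆ U ∧ K ⊆ D by
    obtain ⟨D, h1, h2, -, h4, h5⟩ := h
    exact ⟨D, h1, h2, h5, h4⟩
  refine hK.induction_on
    (p := fun s => ∃ D, IsCompact D ∧ IsConnected D ∧ x₀ ∈ D ∧ D ⊆ U ∧ s ⊆ D) ?_ ?_ ?_ ?_
  · exact ⟨{x₀}, isCompact_singleton, isConnected_singleton, rfl, singleton_subset_iff.2 hx₀,
      empty_subset _⟩
  · rintro s t hst ⟨D, h1, h2, h3, h4, h5⟩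
    exact ⟨D, h1, h2, h3, h4, hst.trans h5⟩
  · rintro s t ⟨D, h1, h2, h3, h4, h5⟩ ⟨E, e1, e2, e3, e4, e5⟩
    exact ⟨D ∪ E, h1.union e1, h2.union ⟨x₀, h3, e3⟩ e2, Or.inl h3, union_subset h4 e4,
      union_subset_union h5 e5⟩
  · intro x hx
    obtain ⟨D, h1, h2, h3, h4, h5⟩ := hUS (hKU hx)
    exact ⟨D, mem_nhdsWithin_of_mem_nhds h5, D, h1, h2, h3, h4, Subset.rfl⟩

/-- In a connected, locally connected space, the closure of a component of the complement of a
nonempty closed set meets that closed set. -/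
theorem IsClosed.closure_connectedComponentIn_compl_inter_nonempty
    {X : Type*} [TopologicalSpace X] [ConnectedSpace X] [LocallyConnectedSpace X]
    {D : Set X} (hD : IsClosed D) (hne : D.Nonempty) {x : X} (hx : x ∉ D) :
    (closure (connectedComponentIn Dᶜ x) ∩ D).Nonempty := by
  by_contra h
  have hdisj : closure (connectedComponentIn Dᶜ x) ⊆ Dᶜ := fun y hy hyD => h ⟨y, hy, hyD⟩
  have hxB : x ∈ connectedComponentIn Dᶜ x := mem_connectedComponentIn hx
  have hclosed : IsClosed (connectedComponentIn Dᶜ x) := isClosed_of_closure_subset <|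
    isPreconnected_connectedComponentIn.closure.subset_connectedComponentIn
      (subset_closure hxB) hdisj
  have huniv := IsClopen.eq_univ ⟨hclosed, hD.isOpen_compl.connectedComponentIn⟩ ⟨x, hxB⟩
  obtain ⟨d, hd⟩ := hne
  exact connectedComponentIn_subset Dᶜ x (huniv ▸ mem_univ d) hd

/-- The solid hull of `D`: the union of `D` and the bounded components of its complement. -/
def solidHull {X : Type*} [TopologicalSpace X] (D : Set X) : Set X :=
  {x | x ∈ Dᶜ → IsCompact (closure (connectedComponentIn Dᶜ x))}

theorem subset_solidHull {X : Type*} [TopologicalSpace X] (D : Set X) : D ⊆ solidHull D :=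
  fun _ hx hx' => absurd hx hx'

theorem isClosed_solidHull {X : Type*} [TopologicalSpace X] [LocallyConnectedSpace X]
    {D : Set X} (hD : IsClosed D) : IsClosed (solidHull D) := by
  refine isOpen_compl_iff.1 (isOpen_iff_mem_nhds.2 fun x hx => ?_)
  obtain ⟨hxD, hxc⟩ := Classical.not_imp.1 hx
  filter_upwards [hD.isOpen_compl.connectedComponentIn.mem_nhds (mem_connectedComponentIn hxD)]
    with y hy hy'
  rw [connectedComponentIn_eq hy] at hxc
  exact hxc (hy' (connectedComponentIn_subset _ _ hy))

theorem isConnected_solidHull {X : Type*} [TopologicalSpace X] [ConnectedSpace X]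
    [LocallyConnectedSpace X] {D : Set X} (hD : IsClosed D) (hDc : IsConnected D) :
    IsConnected (solidHull D) := by
  obtain ⟨d, hd⟩ := hDc.nonempty
  refine ⟨⟨d, subset_solidHull D hd⟩, isPreconnected_of_forall d fun y hy => ?_⟩
  by_cases hyD : y ∈ D
  · exact ⟨D, subset_solidHull D, hd, hyD, hDc.isPreconnected⟩
  obtain ⟨p, hpB, hpD⟩ := hD.closure_connectedComponentIn_compl_inter_nonempty hDc.nonempty hyD
  have hB : IsPreconnected (insert p (connectedComponentIn Dᶜ y)) :=
    isPreconnected_connectedComponentIn.subset_closure (subset_insert _ _)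
      (insert_subset hpB subset_closure)
  refine ⟨D ∪ insert p (connectedComponentIn Dᶜ y), ?_, Or.inl hd,
    Or.inr (Or.inr (mem_connectedComponentIn hyD)),
    hDc.isPreconnected.union p hpD (mem_insert _ _) hB⟩
  refine union_subset (subset_solidHull D) (insert_subset (subset_solidHull D hpD) fun z hz _ => ?_)
  rw [← connectedComponentIn_eq hz]
  exact hy hyD

theorem solid_solidHull {X : Type*} [TopologicalSpace X] [ConnectedSpace X]
    [LocallyConnectedSpace X] {D : Set X} (hD : IsClosed D) (hDc : IsConnected D) :
    Solid (solidHull D) := by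
  refine ⟨isConnected_solidHull hD hDc, ?_⟩
  rintro _ ⟨x, hx, rfl⟩ hcomp
  obtain ⟨hxD, hxc⟩ := Classical.not_imp.1 hx
  refine hxc (hcomp.of_isClosed_subset isClosed_closure (closure_mono ?_))
  refine isPreconnected_connectedComponentIn.subset_connectedComponentIn
    (mem_connectedComponentIn hxD) fun z hz hz' => hxc ?_
  rw [connectedComponentIn_eq hz]
  exact hz' (connectedComponentIn_subset _ _ hz)

theorem Solid.solidHull_subset {X : Type*} [TopologicalSpace X] {D U : Set X} (hU : Solid U)
    (hDU : D ⊆ U) : solidHull D ⊆ U := by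
  intro x hx
  by_contra hxU
  refine hU.2 _ ⟨x, hxU, rfl⟩ ((hx fun hxD => hxU (hDU hxD)).of_isClosed_subset isClosed_closure
    (closure_mono (connectedComponentIn_mono x (compl_subset_compl.2 hDU))))

/-- Let `X` be a locally compact, connected, locally connected Hausdorff space. If `K ⊆ U`
with `K` compact and `U` open solid with compact closure, then there is a compact solid `C`
with `K ⊆ C ⊆ U`. -/
theorem exists_compact_solid_between
    {X : Type*} [TopologicalSpace X] [LocallyCompactSpace X] [ConnectedSpace X]
    [LocallyConnectedSpace X] [T2Space X] (K U : Set X) (hK : IsCompact K)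
    (hU : IsOpen U) (hUs : Solid U) (hUb : IsCompact (closure U)) (hKU : K ⊆ U) :
    ∃ C : Set X, IsCompact C ∧ Solid C ∧ K ⊆ C ∧ C ⊆ U := by
  obtain ⟨D, hD, hDc, hKD, hDU⟩ := hK.exists_isCompact_isConnected_between hU hUs.1 hKU
  have hsub := hUs.solidHull_subset hDU
  exact ⟨solidHull D,
    hUb.of_isClosed_subset (isClosed_solidHull hD.isClosed) (hsub.trans subset_closure),
    solid_solidHull hD.isClosed hDc, hKD.trans (subset_solidHull D), hsub⟩
end

section
/- Let X be a locally compact, connected, locally connected Hausdorff space. Let K ⊆ V where K is a compact solid set and V is open. Then there exists an open solid set W with compact closure such that K ⊆ W ⊆ closure(W) ⊆ V. -/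
open Set

open scoped Topology

/-- A preconnected set meeting both a set and its complement meets the frontier of that set. -/
theorem IsPreconnected.inter_frontier_nonempty {X : Type*} [TopologicalSpace X] {s t : Set X}
    (hs : IsPreconnected s) (h : (s ∩ t).Nonempty) (h' : (s ∩ tᶜ).Nonempty) :
    (s ∩ frontier t).Nonempty := by
  by_contra hemp
  have hfr : ∀ x ∈ s, x ∈ closure t → x ∈ interior t := fun x hx hxt => by
    by_contra hxi
    exact hemp ⟨x, hx, hxt, hxi⟩
  obtain ⟨x, hx, hxt⟩ := h
  obtain ⟨y, hy, hyt⟩ := h'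
  obtain ⟨z, -, hzi, hzc⟩ := hs (interior t) (closure t)ᶜ isOpen_interior
    isClosed_closure.isOpen_compl
    (fun z hz => (em (z ∈ closure t)).imp (hfr z hz) id)
    ⟨x, hx, hfr x hx (subset_closure hxt)⟩
    ⟨y, hy, fun hyc => hyt (interior_subset (hfr y hy hyc))⟩
  exact hzc (interior_subset_closure hzi)

/-- In a connected, locally connected space, a component of an open set which is not the whole
space accumulates at the complement of the open set. -/
theorem exists_mem_closure_connectedComponentIn_notMem {X : Type*} [TopologicalSpace X]
    [ConnectedSpace X] [LocallyConnectedSpace X] {S : Set X} (hS : IsOpen S) {x : X} (hx : x ∈ S)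
    (hne : connectedComponentIn S x ≠ univ) :
    ∃ y ∈ closure (connectedComponentIn S x), y ∉ S := by
  by_contra! h
  have hsub : closure (connectedComponentIn S x) ⊆ connectedComponentIn S x :=
    isPreconnected_connectedComponentIn.closure.subset_connectedComponentIn
      (subset_closure (mem_connectedComponentIn hx)) h
  have hclopen : IsClopen (connectedComponentIn S x) :=
    ⟨closure_subset_iff_isClosed.1 hsub, hS.connectedComponentIn⟩
  exact hne (hclopen.eq_univ ⟨x, mem_connectedComponentIn hx⟩)

/-- A set is bounded as soon as it only meets bounded components of the complement of a nonempty
compact set. -/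
theorem isCompact_closure_of_forall_connectedComponentIn_compl {X : Type*} [TopologicalSpace X]
    [LocallyCompactSpace X] [ConnectedSpace X] [LocallyConnectedSpace X] [T2Space X]
    {L C : Set X} (hL : IsCompact L) (hne : L.Nonempty)
    (hC : ∀ c ∈ C, c ∉ L → IsCompact (closure (connectedComponentIn Lᶜ c))) :
    IsCompact (closure C) := by
  obtain ⟨M, hM, hLM⟩ := exists_compact_superset hL
  have hopen : IsOpen Lᶜ := hL.isClosed.isOpen_compl
  have hfr : IsCompact (frontier M) :=
    hM.of_isClosed_subset isClosed_frontier hM.isClosed.frontier_subset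
  have hfrL : ∀ y ∈ frontier M, y ∈ Lᶜ := fun y hy hyL => hy.2 (hLM hyL)
  obtain ⟨t, -, ht⟩ := hfr.elim_nhds_subcover (fun y => connectedComponentIn Lᶜ y)
    fun y hy => hopen.connectedComponentIn.mem_nhds (mem_connectedComponentIn (hfrL y hy))
  classical
  let s := t.filter fun y => IsCompact (closure (connectedComponentIn Lᶜ y))
  have hcomp : IsCompact (M ∪ ⋃ y ∈ s, closure (connectedComponentIn Lᶜ y)) :=
    hM.union (s.isCompact_biUnion fun y hy => (Finset.mem_filter.1 hy).2)
  refine hcomp.of_isClosed_subset isClosed_closure (closure_minimal ?_ hcomp.isClosed)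
  intro c hc
  by_cases hcM : c ∈ M
  · exact Or.inl hcM
  right
  have hcL : c ∈ Lᶜ := fun h => hcM (interior_subset (hLM h))
  have hcc := mem_connectedComponentIn hcL
  have hD : connectedComponentIn Lᶜ c ≠ univ := by
    intro h
    obtain ⟨l, hl⟩ := hne
    exact connectedComponentIn_subset Lᶜ c (h ▸ mem_univ l) hl
  obtain ⟨z, hz, hzL⟩ := exists_mem_closure_connectedComponentIn_notMem hopen hcL hD
  obtain ⟨w, hwM, hw⟩ := mem_closure_iff.1 hz _ isOpen_interior (hLM (not_not.1 hzL))
  obtain ⟨y, hy, hyM⟩ := isPreconnected_connectedComponentIn.inter_frontier_nonempty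
    (t := M) ⟨w, hw, interior_subset hwM⟩ ⟨c, hcc, hcM⟩
  obtain ⟨x, hxt, hyx⟩ := mem_iUnion₂.1 (ht hyM)
  have heq : connectedComponentIn Lᶜ c = connectedComponentIn Lᶜ x :=
    (connectedComponentIn_eq hy).trans (connectedComponentIn_eq hyx).symm
  refine mem_iUnion₂.2 ⟨x, Finset.mem_filter.2 ⟨hxt, ?_⟩, subset_closure (heq ▸ hcc)⟩
  exact heq ▸ hC c hc hcL

/-- Every point off a compact solid set has an unbounded connected neighborhood whose closure
avoids that set. -/
theorem Solid.exists_mem_nhds_unbounded {X : Type*} [TopologicalSpace X]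
    [LocallyCompactSpace X] [ConnectedSpace X] [LocallyConnectedSpace X] [T2Space X]
    {K : Set X} (hKs : Solid K) (hK : IsCompact K) {q : X} (hq : q ∈ Kᶜ) :
    ∃ T ∈ 𝓝 q, IsPreconnected T ∧ closure T ⊆ Kᶜ ∧ ¬ IsCompact (closure T) := by
  have hopen : IsOpen Kᶜ := hK.isClosed.isOpen_compl
  let G : Set X :=
    {p | ∃ T ∈ 𝓝 p, IsPreconnected T ∧ closure T ⊆ Kᶜ ∧ ¬ IsCompact (closure T)}
  have hG : IsOpen G := isOpen_iff_mem_nhds.2 fun p ⟨T, hT, h⟩ => by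
    filter_upwards [eventually_mem_nhds_iff.2 hT] with r hr using ⟨T, hr, h⟩
  suffices h : connectedComponentIn Kᶜ q ⊆ G from h (mem_connectedComponentIn hq)
  refine isPreconnected_connectedComponentIn.subset_of_closure_inter_subset hG ?_ ?_
  · obtain ⟨L, hL, hKL⟩ := exists_compact_superset hK
    have hLK : Lᶜ ⊆ Kᶜ := compl_subset_compl.2 (hKL.trans interior_subset)
    have hunb := hKs.2 _ ⟨q, hq, rfl⟩
    have hex : ∃ c ∈ connectedComponentIn Kᶜ q, c ∉ L ∧
        ¬ IsCompact (closure (connectedComponentIn Lᶜ c)) := by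
      by_contra! h
      exact hunb (isCompact_closure_of_forall_connectedComponentIn_compl hL
        (hKs.1.nonempty.mono (hKL.trans interior_subset)) h)
    obtain ⟨c, hc, hcL, hcunb⟩ := hex
    refine ⟨c, hc, connectedComponentIn Lᶜ c,
      hL.isClosed.isOpen_compl.connectedComponentIn.mem_nhds (mem_connectedComponentIn hcL),
      isPreconnected_connectedComponentIn, ?_, hcunb⟩
    calc closure (connectedComponentIn Lᶜ c) ⊆ closure Lᶜ :=
          closure_mono (connectedComponentIn_subset _ _)
      _ = (interior L)ᶜ := closure_compl
      _ ⊆ Kᶜ := compl_subset_compl.2 hKL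
  · rintro p ⟨hpG, hp⟩
    have hpK : p ∈ Kᶜ := connectedComponentIn_subset _ _ hp
    obtain ⟨A, hA, hAc, hAK⟩ := exists_mem_nhds_isClosed_subset (hopen.mem_nhds hpK)
    have hpA : p ∈ interior A := mem_interior_iff_mem_nhds.2 hA
    have hU : connectedComponentIn (interior A) p ∈ 𝓝 p :=
      isOpen_interior.connectedComponentIn.mem_nhds (mem_connectedComponentIn hpA)
    obtain ⟨g, hgU, T, hT, hTc, hTK, hTunb⟩ := mem_closure_iff_nhds.1 hpG _ hU
    refine ⟨connectedComponentIn (interior A) p ∪ T, Filter.mem_of_superset hU subset_union_left,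
      isPreconnected_connectedComponentIn.union g hgU (mem_of_mem_nhds hT) hTc, ?_, ?_⟩
    · rw [closure_union]
      refine union_subset ((closure_minimal ?_ hAc).trans hAK) hTK
      exact (connectedComponentIn_subset _ _).trans interior_subset
    · exact fun h => hTunb
        (h.of_isClosed_subset isClosed_closure (closure_mono subset_union_right))

/-- Let `X` be a locally compact, connected, locally connected Hausdorff space, `K ⊆ V` with
`K` compact solid and `V` open. Then there is an open solid `W` with compact closure such that
`K ⊆ W ⊆ closure W ⊆ V`. -/
theorem exists_open_solid_between
    {X : Type*} [TopologicalSpace X] [LocallyCompactSpace X] [ConnectedSpace X]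
    [LocallyConnectedSpace X] [T2Space X] (K V : Set X) (hK : IsCompact K)
    (hKs : Solid K) (hV : IsOpen V) (hKV : K ⊆ V) :
    ∃ W : Set X, IsOpen W ∧ Solid W ∧ IsCompact (closure W) ∧
      K ⊆ W ∧ closure W ⊆ V := by
  obtain ⟨O, hO, hKO, hOV, hOc⟩ := exists_open_between_and_isCompact_closure hK hV hKV
  have hfr : IsCompact (frontier O) :=
    hOc.of_isClosed_subset isClosed_frontier frontier_subset_closure
  have hfrK : ∀ q ∈ frontier O, q ∈ Kᶜ := fun q hq hqK =>
    hq.2 (hO.interior_eq.symm ▸ hKO hqK)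
  choose! T hTn hTc hTK hTunb using
    fun q (hq : q ∈ Kᶜ) => hKs.exists_mem_nhds_unbounded hK hq
  obtain ⟨t, htf, ht⟩ := hfr.elim_nhds_subcover T fun q hq => hTn q (hfrK q hq)
  let F : Set X := ⋃ q ∈ t, closure (T q)
  have hF : IsClosed F := t.finite_toSet.isClosed_biUnion fun _ _ => isClosed_closure
  have hKF : K ⊆ Fᶜ := fun k hk hkF => by
    obtain ⟨q, hq, hkq⟩ := mem_iUnion₂.1 hkF
    exact hTK q (hfrK q (htf q hq)) hkq hk
  obtain ⟨k, hk⟩ := hKs.1.nonempty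
  let W := connectedComponentIn Fᶜ k
  have hW : IsOpen W := hF.isOpen_compl.connectedComponentIn
  have hkW : k ∈ W := mem_connectedComponentIn (hKF hk)
  have hWF : W ⊆ Fᶜ := connectedComponentIn_subset _ _
  have hWO : W ⊆ O := by
    by_contra h
    obtain ⟨w, hw, hwO⟩ := not_subset.1 h
    obtain ⟨y, hyW, hy⟩ := isPreconnected_connectedComponentIn.inter_frontier_nonempty
      (t := O) ⟨k, hkW, hKO hk⟩ ⟨w, hw, hwO⟩
    obtain ⟨q, hq, hyq⟩ := mem_iUnion₂.1 (ht hy)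
    exact hWF hyW (mem_iUnion₂.2 ⟨q, hq, subset_closure hyq⟩)
  have hunb : ∀ B : Set X, IsPreconnected B → B ⊆ Wᶜ → ∀ x ∈ B, ∀ y ∈ B, y ∈ F →
      ¬ IsCompact (closure (connectedComponentIn Wᶜ x)) := by
    intro B hB hBW x hx y hy hyF hcomp
    obtain ⟨q, hq, hyq⟩ := mem_iUnion₂.1 hyF
    have hqK := hfrK q (htf q hq)
    have hqF : closure (T q) ⊆ F := fun z hz => mem_iUnion₂.2 ⟨q, hq, hz⟩
    have hsub : B ∪ closure (T q) ⊆ connectedComponentIn Wᶜ x :=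
      (hB.union y hy hyq (hTc q hqK).closure).subset_connectedComponentIn (Or.inl hx)
        (union_subset hBW fun z hz hzW => hWF hzW (hqF hz))
    exact hTunb q hqK (hcomp.of_isClosed_subset isClosed_closure
      ((subset_union_right.trans hsub).trans subset_closure))
  refine ⟨W, hW, ⟨⟨⟨k, hkW⟩, isPreconnected_connectedComponentIn⟩, ?_⟩,
    hOc.of_isClosed_subset isClosed_closure (closure_mono hWO),
    hKs.1.isPreconnected.subset_connectedComponentIn hk hKF, (closure_mono hWO).trans hOV⟩
  rintro _ ⟨x, hx, rfl⟩
  by_cases hxF : x ∈ F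
  · exact hunb {x} isPreconnected_singleton (singleton_subset_iff.2 hx) x rfl x rfl hxF
  have hdisj : Disjoint W (connectedComponentIn Fᶜ x) := by
    refine disjoint_left.2 fun z hzW hz => hx ?_
    have heq : W = connectedComponentIn Fᶜ x :=
      (connectedComponentIn_eq hzW).trans (connectedComponentIn_eq hz).symm
    exact heq ▸ mem_connectedComponentIn hxF
  have hne : connectedComponentIn Fᶜ x ≠ univ := fun h =>
    disjoint_left.1 hdisj hkW (h ▸ mem_univ k)
  obtain ⟨y, hy, hyF⟩ :=
    exists_mem_closure_connectedComponentIn_notMem hF.isOpen_compl hxF hne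
  exact hunb _ isPreconnected_connectedComponentIn.closure
    (hdisj.closure_right hW).subset_compl_left x
    (subset_closure (mem_connectedComponentIn hxF)) y hy (not_not.1 hyF)
end

section
/- Let X be a locally compact, connected, locally connected Hausdorff space. Suppose K ⊆ W where K is compact and connected and W is an open semi-solid set. Then there exist an open semi-solid set V with compact closure and a compact semi-solid set D such that K ⊆ V ⊆ D ⊆ W. -/
open Set

/-- A set is semi-solid if it is connected and its complement has only finitely many
connected components. -/
def SemiSolid {X : Type*} [TopologicalSpace X] (A : Set X) : Prop :=
  IsConnected A ∧ {C : Set X | IsCompOf C Aᶜ}.Finite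

open Topology

section ConnectedUnions

variable {X : Type*} [TopologicalSpace X]

theorem IsPreconnected.union_sUnion_of_closure_inter_nonempty {A : Set X} {𝒞 : Set (Set X)}
    (hA : IsPreconnected A) (h𝒞 : ∀ C ∈ 𝒞, IsPreconnected C ∧ (closure C ∩ A).Nonempty) :
    IsPreconnected (A ∪ ⋃₀ 𝒞) := by
  rcases A.eq_empty_or_nonempty with rfl | ⟨p, hp⟩
  · have : 𝒞 = ∅ := eq_empty_of_forall_notMem fun C hC => by simpa using (h𝒞 C hC).2
    simpa [this] using isPreconnected_empty
  refine isPreconnected_of_forall p ?_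
  rintro y (hy | ⟨C, hC, hy⟩)
  · exact ⟨A, subset_union_left, hp, hy, hA⟩
  · obtain ⟨hCc, z, hzC, hzA⟩ := h𝒞 C hC
    have hins : IsPreconnected (insert z C) :=
      hCc.subset_closure (subset_insert _ _) (insert_subset hzC subset_closure)
    refine ⟨A ∪ insert z C, ?_, Or.inl hp, Or.inr (Or.inr hy),
      hA.union z hzA (mem_insert _ _) hins⟩
    exact union_subset subset_union_left (insert_subset (Or.inl hzA)
      (subset_union_of_subset_right (subset_sUnion_of_mem hC) _))

theorem finite_setOf_isCompOf_sUnion {𝒯 : Set (Set X)} (hfin : 𝒯.Finite)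
    (hconn : ∀ C ∈ 𝒯, IsPreconnected C) : {C : Set X | IsCompOf C (⋃₀ 𝒯)}.Finite := by
  classical
  refine (hfin.image fun F : Set X =>
    if h : F.Nonempty then connectedComponentIn (⋃₀ 𝒯) h.some else ∅).subset ?_
  rintro C ⟨x, ⟨F, hF, hxF⟩, rfl⟩
  have hne : F.Nonempty := ⟨x, hxF⟩
  refine ⟨F, hF, ?_⟩
  simp only [hne, dif_pos]
  exact (connectedComponentIn_eq ((hconn F hF).subset_connectedComponentIn hxF
    (subset_sUnion_of_mem hF) hne.some_mem)).symm

theorem IsCompOf.isPreconnected {C S : Set X} (h : IsCompOf C S) : IsPreconnected C := by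
  obtain ⟨x, -, rfl⟩ := h
  exact isPreconnected_connectedComponentIn

theorem IsCompOf.subset {C S : Set X} (h : IsCompOf C S) : C ⊆ S := by
  obtain ⟨x, -, rfl⟩ := h
  exact connectedComponentIn_subset _ _

theorem IsCompOf.nonempty {C S : Set X} (h : IsCompOf C S) : C.Nonempty := by
  obtain ⟨x, hx, rfl⟩ := h
  exact ⟨x, mem_connectedComponentIn hx⟩

theorem IsCompOf.eq_of_mem {C D S : Set X} (hC : IsCompOf C S) (hD : IsCompOf D S) {y : X}
    (hyC : y ∈ C) (hyD : y ∈ D) : C = D := by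
  obtain ⟨x, -, rfl⟩ := hC
  obtain ⟨z, -, rfl⟩ := hD
  rw [connectedComponentIn_eq hyC, connectedComponentIn_eq hyD]

theorem sUnion_setOf_isCompOf (S : Set X) : ⋃₀ {C | IsCompOf C S} = S :=
  Subset.antisymm (sUnion_subset fun _ hC => hC.subset) fun x hx =>
    ⟨_, ⟨x, hx, rfl⟩, mem_connectedComponentIn hx⟩

theorem IsCompOf.closure_inter_subset {C S : Set X} (h : IsCompOf C S) : closure C ∩ S ⊆ C := by
  obtain ⟨x, hx, rfl⟩ := h
  exact (isPreconnected_connectedComponentIn.subset_closure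
    (subset_inter subset_closure (connectedComponentIn_subset _ _))
    inter_subset_left).subset_connectedComponentIn
      ⟨subset_closure (mem_connectedComponentIn hx), hx⟩ inter_subset_right

theorem IsCompOf.isOpen [LocallyConnectedSpace X] {C S : Set X} (h : IsCompOf C S)
    (hS : IsOpen S) : IsOpen C := by
  obtain ⟨x, -, rfl⟩ := h
  exact hS.connectedComponentIn

theorem IsCompOf.closure_inter_compl_nonempty [ConnectedSpace X] [LocallyConnectedSpace X]
    {C S : Set X} (h : IsCompOf C S) (hS : IsOpen S) (hC : C ≠ univ) :
    (closure C ∩ Sᶜ).Nonempty := by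
  by_contra hne
  have hsub : closure C ⊆ S := by
    simpa [not_nonempty_iff_eq_empty, ← sdiff_eq, sdiff_eq_empty] using hne
  have hclosed : IsClosed C :=
    closure_subset_iff_isClosed.1 fun x hx => h.closure_inter_subset ⟨hx, hsub hx⟩
  exact hC (IsClopen.eq_univ ⟨hclosed, h.isOpen hS⟩ h.nonempty)

end ConnectedUnions

section ComplementComponents

variable {X : Type*} [TopologicalSpace X] [ConnectedSpace X] [LocallyConnectedSpace X] [T2Space X]
  {K U : Set X}

/-- Only finitely many components of the complement of a compact set `K` leave a given
relatively compact open neighbourhood of `K`. -/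
theorem finite_setOf_isCompOf_compl_not_subset (hK : IsCompact K) (hKne : K.Nonempty)
    (hU : IsOpen U) (hUc : IsCompact (closure U)) (hKU : K ⊆ U) :
    {C | IsCompOf C Kᶜ ∧ ¬ C ⊆ U}.Finite := by
  have hKo : IsOpen Kᶜ := hK.isClosed.isOpen_compl
  have hfr : IsCompact (frontier U) :=
    hUc.of_isClosed_subset isClosed_frontier frontier_subset_closure
  obtain ⟨b, hb, hbfin, hcov⟩ := hfr.elim_finite_subcover_image (b := {C | IsCompOf C Kᶜ})
    (c := id) (fun C hC => hC.isOpen hKo) (by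
      simp only [id_eq]
      rw [← sUnion_eq_biUnion, sUnion_setOf_isCompOf]
      intro x hx hxK
      rw [hU.frontier_eq] at hx
      exact hx.2 (hKU hxK))
  refine hbfin.subset ?_
  rintro C ⟨hC, hCU⟩
  have hCuniv : C ≠ univ := by
    rintro rfl
    obtain ⟨k, hk⟩ := hKne
    exact hC.subset (mem_univ k) hk
  have hmeet : (C ∩ U).Nonempty := by
    obtain ⟨z, hzC, hzK⟩ := hC.closure_inter_compl_nonempty hKo hCuniv
    rw [compl_compl] at hzK
    rw [inter_comm]
    exact (mem_closure_iff.1 hzC U hU (hKU hzK))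
  have : (C ∩ frontier U).Nonempty := by
    by_contra hne
    refine hCU (hC.isPreconnected.subset_of_closure_inter_subset hU hmeet ?_)
    rintro x ⟨hxU, hxC⟩
    by_contra hx
    exact hne ⟨x, hxC, by rw [hU.frontier_eq]; exact ⟨hxU, hx⟩⟩
  obtain ⟨x, hxC, hxfr⟩ := this
  obtain ⟨D, hDb, hxD⟩ := mem_iUnion₂.1 (hcov hxfr)
  rwa [hC.eq_of_mem (hb hDb) hxC hxD]

/-- A compact connected set `K` is enlarged to a compact semi-solid set by adding the components
of its complement that lie in a given relatively compact open neighbourhood of `K`. -/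
theorem exists_isCompact_semiSolid_between (hK : IsCompact K) (hKc : IsConnected K)
    (hU : IsOpen U) (hUc : IsCompact (closure U)) (hKU : K ⊆ U) :
    ∃ D, IsCompact D ∧ SemiSolid D ∧ K ⊆ D ∧ D ⊆ U := by
  have hKo : IsOpen Kᶜ := hK.isClosed.isOpen_compl
  set 𝒯 := {C | IsCompOf C Kᶜ ∧ ¬ C ⊆ U}
  have heq : (⋃₀ 𝒯)ᶜ = K ∪ ⋃₀ {C | IsCompOf C Kᶜ ∧ C ⊆ U} := by
    ext x
    constructor
    · intro hx
      by_cases hxK : x ∈ K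
      · exact Or.inl hxK
      have hcomp : IsCompOf (connectedComponentIn Kᶜ x) Kᶜ := ⟨x, hxK, rfl⟩
      have hmem : x ∈ connectedComponentIn Kᶜ x := mem_connectedComponentIn hxK
      by_cases hsub : connectedComponentIn Kᶜ x ⊆ U
      · exact Or.inr ⟨_, ⟨hcomp, hsub⟩, hmem⟩
      · exact absurd ⟨_, ⟨hcomp, hsub⟩, hmem⟩ hx
    · rintro (hxK | ⟨C, ⟨hC, hCU⟩, hxC⟩) ⟨E, ⟨hE, hEU⟩, hxE⟩
      · exact hE.subset hxE hxK
      · exact hEU (hC.eq_of_mem hE hxC hxE ▸ hCU)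
  have hKD : K ⊆ (⋃₀ 𝒯)ᶜ := heq ▸ subset_union_left
  have hDU : (⋃₀ 𝒯)ᶜ ⊆ U := heq ▸ union_subset hKU (sUnion_subset fun C hC => hC.2)
  have hDclosed : IsClosed (⋃₀ 𝒯)ᶜ :=
    (isOpen_sUnion fun C hC => hC.1.isOpen hKo).isClosed_compl
  refine ⟨(⋃₀ 𝒯)ᶜ, hUc.of_isClosed_subset hDclosed (hDU.trans subset_closure),
    ⟨⟨hKc.nonempty.mono hKD, ?_⟩, ?_⟩, hKD, hDU⟩
  · rw [heq]
    refine hKc.isPreconnected.union_sUnion_of_closure_inter_nonempty fun C hC =>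
      ⟨hC.1.isPreconnected, ?_⟩
    have := hC.1.closure_inter_compl_nonempty hKo (by
      rintro rfl
      obtain ⟨k, hk⟩ := hKc.nonempty
      exact hC.1.subset (mem_univ k) hk)
    rwa [compl_compl] at this
  · rw [compl_compl]
    exact finite_setOf_isCompOf_sUnion
      (finite_setOf_isCompOf_compl_not_subset hK hKc.nonempty hU hUc hKU)
      fun C hC => hC.1.isPreconnected

end ComplementComponents

section LocallyCompact

variable {X : Type*} [TopologicalSpace X] [LocallyCompactSpace X] [LocallyConnectedSpace X]
  [T2Space X]

theorem IsOpen.exists_isCompact_isPreconnected_mem_nhds {E : Set X} (hE : IsOpen E) {x : X}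
    (hx : x ∈ E) : ∃ G ∈ 𝓝 x, IsCompact G ∧ IsPreconnected G ∧ G ⊆ E := by
  obtain ⟨N, hN, hxN, hNE⟩ := exists_compact_subset hE hx
  obtain ⟨V, hVN, hV, hxV, hVc⟩ :=
    locallyConnectedSpace_iff_subsets_isOpen_isConnected.1 ‹_› x _ (isOpen_interior.mem_nhds hxN)
  have hcl : closure V ⊆ N := closure_minimal (hVN.trans interior_subset) hN.isClosed
  exact ⟨closure V, Filter.mem_of_superset (hV.mem_nhds hxV) subset_closure,
    hN.of_isClosed_subset isClosed_closure hcl, hVc.isPreconnected.closure, hcl.trans hNE⟩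

/-- In an open connected set `E`, every compact subset lies in a compact connected subset. -/
theorem IsOpen.exists_isCompact_isPreconnected_superset {E Q : Set X} (hE : IsOpen E)
    (hEc : IsPreconnected E) (hQ : IsCompact Q) (hQE : Q ⊆ E) :
    ∃ G, IsCompact G ∧ IsPreconnected G ∧ Q ⊆ G ∧ G ⊆ E := by
  rcases Q.eq_empty_or_nonempty with rfl | ⟨p, hpQ⟩
  · exact ⟨∅, isCompact_empty, isPreconnected_empty, Subset.rfl, empty_subset _⟩
  have hpE := hQE hpQ
  have key : ∀ q ∈ E, ∃ G, IsCompact G ∧ IsPreconnected G ∧ p ∈ G ∧ q ∈ G ∧ G ⊆ E := by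
    intro q hq
    refine hEc.induction₂'
      (fun x y => ∃ G, IsCompact G ∧ IsPreconnected G ∧ x ∈ G ∧ y ∈ G ∧ G ⊆ E) ?_ ?_ hpE hq
    · intro x hx
      obtain ⟨G, hGx, hG, hGc, hGE⟩ := hE.exists_isCompact_isPreconnected_mem_nhds hx
      filter_upwards [mem_nhdsWithin_of_mem_nhds hGx] with y hy
      have hxG := mem_of_mem_nhds hGx
      exact ⟨⟨G, hG, hGc, hxG, hy, hGE⟩, ⟨G, hG, hGc, hy, hxG, hGE⟩⟩
    · rintro x y z - - - ⟨G, hG, hGc, hxG, hyG, hGE⟩ ⟨H, hH, hHc, hyH, hzH, hHE⟩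
      exact ⟨G ∪ H, hG.union hH, hGc.union y hyG hyH hHc, Or.inl hxG, Or.inr hzH,
        union_subset hGE hHE⟩
  have : ∃ G, IsCompact G ∧ IsPreconnected G ∧ p ∈ G ∧ Q ⊆ G ∧ G ⊆ E := by
    refine hQ.induction_on (p := fun s =>
      ∃ G, IsCompact G ∧ IsPreconnected G ∧ p ∈ G ∧ s ⊆ G ∧ G ⊆ E) ?_ ?_ ?_ ?_
    · exact ⟨{p}, isCompact_singleton, isPreconnected_singleton, rfl, empty_subset _,
        singleton_subset_iff.2 hpE⟩
    · rintro s t hst ⟨G, hG, hGc, hpG, htG, hGE⟩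
      exact ⟨G, hG, hGc, hpG, hst.trans htG, hGE⟩
    · rintro s t ⟨G, hG, hGc, hpG, hsG, hGE⟩ ⟨H, hH, hHc, hpH, htH, hHE⟩
      exact ⟨G ∪ H, hG.union hH, hGc.union p hpG hpH hHc, Or.inl hpG,
        union_subset_union hsG htH, union_subset hGE hHE⟩
    · intro x hx
      obtain ⟨N, hNx, hN, hNc, hNE⟩ := hE.exists_isCompact_isPreconnected_mem_nhds (hQE hx)
      obtain ⟨G, hG, hGc, hpG, hxG, hGE⟩ := key x (hQE hx)
      exact ⟨N, mem_nhdsWithin_of_mem_nhds hNx, G ∪ N, hG.union hN,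
        hGc.union x hxG (mem_of_mem_nhds hNx) hNc, Or.inl hpG, subset_union_right,
        union_subset hGE hNE⟩
  obtain ⟨G, hG, hGc, -, hQG, hGE⟩ := this
  exact ⟨G, hG, hGc, hQG, hGE⟩

variable [ConnectedSpace X] {K U : Set X}

/-- The part of a complementary component of `K` outside an open neighbourhood `U` of `K` can be
enlarged, within the component, to a closed connected set. -/
theorem IsCompOf.exists_isClosed_isPreconnected_between {E : Set X} (hE : IsCompOf E Kᶜ)
    (hK : IsCompact K) (hKne : K.Nonempty)
    (hU : IsOpen U) (hUc : IsCompact (closure U)) (hKU : K ⊆ U) :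
    ∃ F, IsClosed F ∧ IsPreconnected F ∧ E \ U ⊆ F ∧ F ⊆ E := by
  have hKo : IsOpen Kᶜ := hK.isClosed.isOpen_compl
  have hEo : IsOpen E := hE.isOpen hKo
  have hcl : closure E \ U = E \ U := by
    refine Subset.antisymm (fun x hx => ⟨hE.closure_inter_subset ⟨hx.1, fun hxK => ?_⟩, hx.2⟩)
      (sdiff_subset_sdiff_left subset_closure)
    exact hx.2 (hKU hxK)
  have hEUclosed : IsClosed (E \ U) := hcl ▸ isClosed_closure.sdiff hU
  have hQ : IsCompact ((E \ U) ∩ closure U) := hUc.inter_left hEUclosed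
  obtain ⟨G, hG, hGc, hQG, hGE⟩ := hEo.exists_isCompact_isPreconnected_superset
    hE.isPreconnected hQ (inter_subset_left.trans sdiff_subset)
  have hO : IsOpen (E \ closure U) := hEo.sdiff isClosed_closure
  have hOsub : E \ closure U ⊆ E \ U := sdiff_subset_sdiff_right subset_closure
  have heq : G ∪ E \ U = G ∪ ⋃₀ {C | IsCompOf C (E \ closure U)} := by
    rw [sUnion_setOf_isCompOf]
    refine Subset.antisymm (union_subset subset_union_left fun x hx => ?_)
      (union_subset_union_right _ hOsub)
    by_cases hxU : x ∈ closure U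
    · exact Or.inl (hQG ⟨hx, hxU⟩)
    · exact Or.inr ⟨hx.1, hxU⟩
  refine ⟨G ∪ E \ U, hG.isClosed.union hEUclosed, ?_, subset_union_right,
    union_subset hGE sdiff_subset⟩
  rw [heq]
  refine hGc.union_sUnion_of_closure_inter_nonempty fun C hC => ⟨hC.isPreconnected, ?_⟩
  obtain ⟨z, hzC, hzO⟩ := hC.closure_inter_compl_nonempty hO (by
    rintro rfl
    obtain ⟨k, hk⟩ := hKne
    exact hE.subset (hC.subset (mem_univ k)).1 hk)
  have hz : z ∈ E \ U := closure_minimal (hC.subset.trans hOsub) hEUclosed hzC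
  exact ⟨z, hzC, hQG ⟨hz, by_contra fun h => hzO ⟨hz.1, h⟩⟩⟩

theorem exists_isOpen_semiSolid_between (hK : IsCompact K) (hKc : IsConnected K)
    (hU : IsOpen U) (hUc : IsCompact (closure U)) (hKU : K ⊆ U) :
    ∃ V, IsOpen V ∧ SemiSolid V ∧ K ⊆ V ∧ V ⊆ U := by
  have hfin := finite_setOf_isCompOf_compl_not_subset hK hKc.nonempty hU hUc hKU
  set 𝒯 := {C | IsCompOf C Kᶜ ∧ ¬ C ⊆ U}
  have hex : ∀ E : Set X, ∃ F, E ∈ 𝒯 → IsClosed F ∧ IsPreconnected F ∧ E \ U ⊆ F ∧ F ⊆ E := by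
    intro E
    by_cases hE : E ∈ 𝒯
    · obtain ⟨F, hF⟩ :=
        hE.1.exists_isClosed_isPreconnected_between hK hKc.nonempty hU hUc hKU
      exact ⟨F, fun _ => hF⟩
    · exact ⟨∅, fun h => absurd h hE⟩
  choose f hf using hex
  set F := ⋃ E ∈ 𝒯, f E
  have hFclosed : IsClosed F := hfin.isClosed_biUnion fun E hE => (hf E hE).1
  have hUF : Fᶜ ⊆ U := by
    intro x hx
    by_contra hxU
    have hxK : x ∈ Kᶜ := fun h => hxU (hKU h)
    have hmem := mem_connectedComponentIn hxK
    have hT : connectedComponentIn Kᶜ x ∈ 𝒯 := ⟨⟨x, hxK, rfl⟩, fun h => hxU (h hmem)⟩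
    exact hx (mem_iUnion₂.2 ⟨_, hT, (hf _ hT).2.2.1 ⟨hmem, hxU⟩⟩)
  have hKF : K ⊆ Fᶜ := by
    intro x hxK hxF
    obtain ⟨E, hE, hxE⟩ := mem_iUnion₂.1 hxF
    exact hE.1.subset ((hf E hE).2.2.2 hxE) hxK
  obtain ⟨k, hk⟩ := hKc.nonempty
  set V := connectedComponentIn Fᶜ k
  have hVcomp : IsCompOf V Fᶜ := ⟨k, hKF hk, rfl⟩
  have hkV : k ∈ V := mem_connectedComponentIn (hKF hk)
  refine ⟨V, hVcomp.isOpen hFclosed.isOpen_compl, ⟨⟨⟨k, hkV⟩, hVcomp.isPreconnected⟩, ?_⟩,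
    hKc.isPreconnected.subset_connectedComponentIn hk hKF, hVcomp.subset.trans hUF⟩
  let g : Set X → Set X := fun E =>
    f E ∪ ⋃₀ {C | IsCompOf C Fᶜ ∧ C ≠ V ∧ (closure C ∩ f E).Nonempty}
  have hcompl : Vᶜ = ⋃₀ (g '' 𝒯) := by
    rw [sUnion_image]
    refine Subset.antisymm (fun x hx => ?_) ?_
    · by_cases hxF : x ∈ F
      · obtain ⟨E, hE, hxE⟩ := mem_iUnion₂.1 hxF
        exact mem_iUnion₂.2 ⟨E, hE, Or.inl hxE⟩
      have hC : IsCompOf (connectedComponentIn Fᶜ x) Fᶜ := ⟨x, hxF, rfl⟩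
      have hxC := mem_connectedComponentIn (F := Fᶜ) hxF
      have hCV : connectedComponentIn Fᶜ x ≠ V := fun h => hx (h ▸ hxC)
      obtain ⟨z, hzC, hzF⟩ := hC.closure_inter_compl_nonempty hFclosed.isOpen_compl
        fun h => hCV (hC.eq_of_mem hVcomp (h ▸ mem_univ k) hkV)
      rw [compl_compl] at hzF
      obtain ⟨E, hE, hzE⟩ := mem_iUnion₂.1 hzF
      exact mem_iUnion₂.2 ⟨E, hE, Or.inr ⟨_, ⟨hC, hCV, z, hzC, hzE⟩, hxC⟩⟩
    · refine iUnion₂_subset fun E hE => union_subset (fun x hx hxV => ?_)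
        (sUnion_subset fun C hC x hx hxV => hC.2.1 (hC.1.eq_of_mem hVcomp hx hxV))
      exact hVcomp.subset hxV (mem_iUnion₂.2 ⟨E, hE, hx⟩)
  rw [hcompl]
  refine finite_setOf_isCompOf_sUnion (hfin.image g) ?_
  rintro _ ⟨E, hE, rfl⟩
  exact (hf E hE).2.1.union_sUnion_of_closure_inter_nonempty
    fun C hC => ⟨hC.1.isPreconnected, hC.2.2⟩

end LocallyCompact

/-- Let `X` be a locally compact, connected, locally connected Hausdorff space and `K ⊆ W`
with `K` compact connected and `W` open semi-solid. Then there are an open semi-solid `V`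
with compact closure and a compact semi-solid `D` with `K ⊆ V ⊆ D ⊆ W`. -/
theorem exists_semisolid_between
    {X : Type*} [TopologicalSpace X] [LocallyCompactSpace X] [ConnectedSpace X]
    [LocallyConnectedSpace X] [T2Space X] (K W : Set X) (hK : IsCompact K)
    (hKc : IsConnected K) (hW : IsOpen W) (hWss : SemiSolid W) (hKW : K ⊆ W) :
    ∃ V D : Set X, IsOpen V ∧ SemiSolid V ∧ IsCompact (closure V) ∧
      IsCompact D ∧ SemiSolid D ∧ K ⊆ V ∧ V ⊆ D ∧ D ⊆ W := by
  obtain ⟨U', hU', hKU', hU'W, hU'c⟩ := exists_open_between_and_isCompact_closure hK hW hKW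
  obtain ⟨U, hU, hKU, hUU', hUc⟩ := exists_open_between_and_isCompact_closure hK hU' hKU'
  obtain ⟨V, hV, hVs, hKV, hVU⟩ := exists_isOpen_semiSolid_between hK hKc hU hUc hKU
  have hVc : IsCompact (closure V) :=
    hUc.of_isClosed_subset isClosed_closure (closure_mono hVU)
  obtain ⟨D, hD, hDs, hVD, hDU'⟩ := exists_isCompact_semiSolid_between hVc hVs.1.closure hU' hU'c
    ((closure_mono hVU).trans hUU')
  exact ⟨V, D, hV, hVs, hVc, hD, hDs, hKV, subset_closure.trans hVD,
    hDU'.trans (subset_closure.trans hU'W)⟩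
end

section
/- Let X be a locally compact Hausdorff space, and let μ be a set function defined on the open and closed subsets of X with values in [0,∞], not identically ∞, satisfying: (TM2) μ(U) = sup{μ(K) : K compact, K ⊆ U} for every open U; (TM3) μ(F) = inf{μ(U) : U open, F ⊆ U} for every closed F; (c1) μ(U ⊔ V) = μ(U) + μ(V) for any disjoint open sets U, V; and (c2) μ(U) = μ(K) + μ(U ∖ K) whenever K is compact, U is open and K ⊆ U. Then μ also satisfies (TM1): if A, B are disjoint and each of A, B, A ∪ B is compact or open, then μ(A ∪ B) = μ(A) + μ(B). -/
open Set ENNReal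

section Regularity

variable {X : Type*} [TopologicalSpace X] {μ : Set X → ℝ≥0∞}

/-- An inner regular set function is monotone on open sets. -/
theorem mono_isOpen_of_inner_regular
    (hinner : ∀ U : Set X, IsOpen U →
      μ U = ⨆ (K : Set X) (_ : IsCompact K ∧ K ⊆ U), μ K)
    {U V : Set X} (hU : IsOpen U) (hV : IsOpen V) (h : U ⊆ V) : μ U ≤ μ V := by
  rw [hinner U hU, hinner V hV]
  exact iSup₂_le fun K hK => le_iSup₂_of_le K ⟨hK.1, hK.2.trans h⟩ le_rfl

/-- An outer regular set function satisfies `μ F ≤ μ U` for `F` closed inside `U` open. -/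
theorem le_isOpen_of_outer_regular
    (houter : ∀ F : Set X, IsClosed F →
      μ F = ⨅ (U : Set X) (_ : IsOpen U ∧ F ⊆ U), μ U)
    {F U : Set X} (hF : IsClosed F) (hU : IsOpen U) (h : F ⊆ U) : μ F ≤ μ U := by
  rw [houter F hF]
  exact iInf₂_le U ⟨hU, h⟩

/-- An outer regular set function is monotone on closed sets. -/
theorem mono_isClosed_of_outer_regular
    (houter : ∀ F : Set X, IsClosed F →
      μ F = ⨅ (U : Set X) (_ : IsOpen U ∧ F ⊆ U), μ U)
    {F G : Set X} (hF : IsClosed F) (hG : IsClosed G) (h : F ⊆ G) : μ F ≤ μ G := by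
  rw [houter G hG]
  exact le_iInf₂ fun U hU => le_isOpen_of_outer_regular houter hF hU.1 (h.trans hU.2)

/-- A regular set function which is additive on disjoint open sets is additive on disjoint
compact sets. -/
theorem union_isCompact_of_regular [T2Space X]
    (hinner : ∀ U : Set X, IsOpen U →
      μ U = ⨆ (K : Set X) (_ : IsCompact K ∧ K ⊆ U), μ K)
    (houter : ∀ F : Set X, IsClosed F →
      μ F = ⨅ (U : Set X) (_ : IsOpen U ∧ F ⊆ U), μ U)
    (hadd : ∀ U V : Set X, IsOpen U → IsOpen V → Disjoint U V → μ (U ∪ V) = μ U + μ V)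
    {A B : Set X} (hA : IsCompact A) (hB : IsCompact B) (hAB : Disjoint A B) :
    μ (A ∪ B) = μ A + μ B := by
  obtain ⟨P, Q, hP, hQ, hAP, hBQ, hPQ⟩ :=
    SeparatedNhds.of_isCompact_isCompact hA hB hAB
  have hC : IsClosed (A ∪ B) := hA.isClosed.union hB.isClosed
  apply le_antisymm
  · rw [houter A hA.isClosed, houter B hB.isClosed]
    refine ENNReal.le_iInf₂_add_iInf₂ fun U hU V hV => ?_
    calc μ (A ∪ B) ≤ μ (U ∩ P ∪ V ∩ Q) :=
          le_isOpen_of_outer_regular houter hC ((hU.1.inter hP).union (hV.1.inter hQ))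
            (union_subset_union (subset_inter hU.2 hAP) (subset_inter hV.2 hBQ))
      _ = μ (U ∩ P) + μ (V ∩ Q) :=
          hadd _ _ (hU.1.inter hP) (hV.1.inter hQ)
            (hPQ.mono inter_subset_right inter_subset_right)
      _ ≤ μ U + μ V :=
          add_le_add
            (mono_isOpen_of_inner_regular hinner (hU.1.inter hP) hU.1 inter_subset_left)
            (mono_isOpen_of_inner_regular hinner (hV.1.inter hQ) hV.1 inter_subset_left)
  · rw [houter (A ∪ B) hC]
    refine le_iInf₂ fun W hW => ?_
    have hAW : A ⊆ W := subset_union_left.trans hW.2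
    have hBW : B ⊆ W := subset_union_right.trans hW.2
    have hWP := hW.1.inter hP
    have hWQ := hW.1.inter hQ
    calc μ A + μ B ≤ μ (W ∩ P) + μ (W ∩ Q) :=
          add_le_add
            (le_isOpen_of_outer_regular houter hA.isClosed hWP (subset_inter hAW hAP))
            (le_isOpen_of_outer_regular houter hB.isClosed hWQ (subset_inter hBW hBQ))
      _ = μ (W ∩ P ∪ W ∩ Q) :=
          (hadd _ _ hWP hWQ (hPQ.mono inter_subset_right inter_subset_right)).symm
      _ ≤ μ W :=
          mono_isOpen_of_inner_regular hinner (hWP.union hWQ) hW.1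
            (union_subset inter_subset_left inter_subset_left)

/-- A regular set function which is additive on disjoint open sets and splits open sets along
compact subsets is additive on a compact and a disjoint open set with compact union. -/
theorem union_isCompact_isOpen_of_regular [T2Space X]
    (hinner : ∀ U : Set X, IsOpen U →
      μ U = ⨆ (K : Set X) (_ : IsCompact K ∧ K ⊆ U), μ K)
    (houter : ∀ F : Set X, IsClosed F →
      μ F = ⨅ (U : Set X) (_ : IsOpen U ∧ F ⊆ U), μ U)
    (hadd : ∀ U V : Set X, IsOpen U → IsOpen V → Disjoint U V → μ (U ∪ V) = μ U + μ V)
    (hsplit : ∀ K U : Set X, IsCompact K → IsOpen U → K ⊆ U → μ U = μ K + μ (U \ K))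
    {A B : Set X} (hA : IsCompact A) (hB : IsOpen B) (hAB : Disjoint A B)
    (hC : IsCompact (A ∪ B)) : μ (A ∪ B) = μ A + μ B := by
  by_cases hfin : μ A = ∞
  · have hle : μ A ≤ μ (A ∪ B) :=
      mono_isClosed_of_outer_regular houter hA.isClosed hC.isClosed subset_union_left
    rw [hfin, top_le_iff] at hle
    rw [hle, hfin, top_add]
  obtain ⟨W, ⟨hW, hAW⟩, hWfin⟩ : ∃ W : Set X, (IsOpen W ∧ A ⊆ W) ∧ μ W < ∞ := by
    have hlt := lt_top_iff_ne_top.2 hfin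
    rw [houter A hA.isClosed] at hlt
    simpa only [iInf_lt_iff, exists_prop] using hlt
  have hD : IsOpen (W \ (A ∪ B)) := hW.sdiff hC.isClosed
  have hDfin : μ (W \ (A ∪ B)) ≠ ∞ :=
    ((mono_isOpen_of_inner_regular hinner hD hW sdiff_subset).trans_lt hWfin).ne
  have hdiffC : (W ∪ B) \ (A ∪ B) = W \ (A ∪ B) := by
    ext x
    simp only [mem_sdiff, mem_union]
    tauto
  have hdiffA : (W ∪ B) \ A = B ∪ W \ (A ∪ B) := by
    ext x
    have := fun h : x ∈ A => disjoint_left.1 hAB h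
    simp only [mem_sdiff, mem_union]
    tauto
  have hsplitC := hsplit (A ∪ B) (W ∪ B) hC (hW.union hB) (union_subset_union_left B hAW)
  have hsplitA := hsplit A (W ∪ B) hA (hW.union hB) (hAW.trans subset_union_left)
  rw [hdiffC] at hsplitC
  rw [hdiffA, hadd B _ hB hD (disjoint_sdiff_right.mono_left subset_union_right),
    ← add_assoc, hsplitC] at hsplitA
  exact (ENNReal.add_left_inj hDfin).1 hsplitA

end Regularity

/-- Let `X` be a locally compact Hausdorff space and `μ` a set function on subsets of `X`
(with values in `[0,∞]`, not identically `∞` on open and closed sets) satisfying inner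
regularity on open sets (TM2), outer regularity on closed sets (TM3), finite additivity on
disjoint open sets (c1), and `μ U = μ K + μ (U \ K)` for compact `K` inside open `U` (c2).
Then `μ` is finitely additive on the collection of compact and open sets (TM1). -/
theorem tm1_of_regularity_and_splitting
    {X : Type*} [TopologicalSpace X] [LocallyCompactSpace X] [T2Space X]
    (μ : Set X → ℝ≥0∞)
    (hne : ∃ A : Set X, (IsOpen A ∨ IsClosed A) ∧ μ A ≠ ∞)
    (hTM2 : ∀ U : Set X, IsOpen U →
      μ U = ⨆ (K : Set X) (_ : IsCompact K ∧ K ⊆ U), μ K)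
    (hTM3 : ∀ F : Set X, IsClosed F →
      μ F = ⨅ (U : Set X) (_ : IsOpen U ∧ F ⊆ U), μ U)
    (hc1 : ∀ U V : Set X, IsOpen U → IsOpen V → Disjoint U V → μ (U ∪ V) = μ U + μ V)
    (hc2 : ∀ K U : Set X, IsCompact K → IsOpen U → K ⊆ U → μ U = μ K + μ (U \ K)) :
    ∀ A B : Set X, Disjoint A B → (IsCompact A ∨ IsOpen A) → (IsCompact B ∨ IsOpen B) →
      (IsCompact (A ∪ B) ∨ IsOpen (A ∪ B)) → μ (A ∪ B) = μ A + μ B := by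
  have hmixed : ∀ A B : Set X, Disjoint A B → IsCompact A → IsOpen B →
      (IsCompact (A ∪ B) ∨ IsOpen (A ∪ B)) → μ (A ∪ B) = μ A + μ B := by
    rintro A B hAB hA hB (hC | hC)
    · exact union_isCompact_isOpen_of_regular hTM2 hTM3 hc1 hc2 hA hB hAB hC
    · rw [hc2 A (A ∪ B) hA hC subset_union_left, union_sdiff_cancel_left hAB.le_bot]
  rintro A B hAB (hA | hA) (hB | hB) hC
  · exact union_isCompact_of_regular hTM2 hTM3 hc1 hA hB hAB
  · exact hmixed A B hAB hA hB hC
  · rw [union_comm] at hC ⊢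
    rw [hmixed B A hAB.symm hB hA hC, add_comm]
  · exact hc1 A B hA hB hAB
end
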